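/- Suppose there are N in N and an integer d >= 1 such that for all n >= N: s_{n,i} is in {0, d} for all 0 <= i < r_n, s_{n,r_n} = 0, and s_{n,i} is not constant over 0 <= i < r_n. Then limsup_{q -> infinity} (p(q) - (3/2) q) = infinity. -/

import Mathlib

open Filter

/-- The rank-one word sequence: `B 1 = 0` and `B (n+1) = ∏_{i=0}^{r n} B n 1^{s n i}`
over the alphabet `{0,1}` (encoded as `Bool` with `false = 0`, `true = 1`).
The value at `0` is an irrelevant placeholder. -/
def Bseq (r : ℕ → ℕ) (s : ℕ → ℕ → ℕ) : ℕ → List Bool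
  | 0 => [false]
  | 1 => [false]
  | n + 2 =>
      ((List.range (r (n + 1) + 1)).map
        (fun i => Bseq r s (n + 1) ++ List.replicate (s (n + 1) i) true)).flatten

/-- The language of the rank-one subshift: all factors of some `B n`. -/
def InLang (r : ℕ → ℕ) (s : ℕ → ℕ → ℕ) (w : List Bool) : Prop :=
  ∃ n, w <:+: Bseq r s n

/-- The word complexity: the number of words of length `q` in the language. -/
noncomputable def complexity (r : ℕ → ℕ) (s : ℕ → ℕ → ℕ) (q : ℕ) : ℕ :=
  Set.ncard {w : List Bool | w.length = q ∧ InLang r s w}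

/-- The word `A` repeated, with runs of ones of the prescribed lengths in between. -/
def spaced (A : List Bool) : List ℕ → List Bool
  | [] => A
  | g :: t => A ++ (List.replicate g true ++ spaced A t)

theorem spaced_append (A : List Bool) (s : List ℕ) (g : ℕ) (t : List ℕ) :
    spaced A (s ++ g :: t) = spaced A s ++ (List.replicate g true ++ spaced A t) := by
  induction s with
  | nil => rfl
  | cons h s ih => simp [spaced, ih]

theorem suffix_spaced_append (A : List Bool) (s t : List ℕ) :
    spaced A t <:+ spaced A (s ++ t) := by
  induction s with
  | nil => exact List.suffix_rfl
  | cons h s ih =>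
    refine ih.trans ?_
    rw [List.cons_append, spaced, ← List.append_assoc]
    exact List.suffix_append _ _

theorem prefix_spaced_append (A : List Bool) (s t : List ℕ) :
    spaced A s <+: spaced A (s ++ t) := by
  cases t with
  | nil => simp
  | cons g t => rw [spaced_append]; exact List.prefix_append _ _

theorem isInfix_spaced (A : List Bool) {s t : List ℕ} (h : s <:+: t) :
    spaced A s <:+: spaced A t := by
  obtain ⟨p, q, rfl⟩ := h
  exact (suffix_spaced_append A p s).isInfix.trans (prefix_spaced_append A (p ++ s) q).isInfix

theorem prefix_spaced (A : List Bool) (t : List ℕ) : A <+: spaced A t :=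
  prefix_spaced_append A [] t

theorem suffix_spaced (A : List Bool) (t : List ℕ) : A <:+ spaced A t := by
  simpa [spaced] using suffix_spaced_append A t []

theorem spaced_reverse (A : List Bool) (t : List ℕ) :
    (spaced A t).reverse = spaced A.reverse t.reverse := by
  induction t with
  | nil => rfl
  | cons g t ih => simp [spaced, ih, spaced_append]

theorem spaced_replicate_length (A : List Bool) (g m : ℕ) :
    (spaced A (List.replicate m g)).length + g = (m + 1) * (A.length + g) := by
  induction m with
  | zero => simp [spaced]
  | succ m ih =>
    rw [List.replicate_succ, spaced, List.length_append, List.length_append,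
      List.length_replicate]
    linarith

/-- If `A` starts with a zero, then `1 ^ g A` starts with `1 ^ μ` and a letter telling
whether `μ < g`. -/
theorem prefix_replicate_append {A : List Bool} (hA : [false] <+: A) {μ g : ℕ} (h : μ ≤ g) :
    List.replicate μ true ++ [decide (μ < g)] <+: List.replicate g true ++ A := by
  obtain ⟨B, rfl⟩ := hA
  obtain ⟨k, rfl⟩ := Nat.exists_eq_add_of_le h
  cases k with
  | zero => exact ⟨B, by simp⟩
  | succ k =>
    refine ⟨List.replicate k true ++ ([false] ++ B), ?_⟩
    simp [List.replicate_add, List.replicate_succ]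

theorem suffix_append_replicate {A : List Bool} (hA : [false] <:+ A) {μ g : ℕ} (h : μ ≤ g) :
    decide (μ < g) :: List.replicate μ true <:+ A ++ List.replicate g true := by
  have := prefix_replicate_append (A := A.reverse) (by simpa using List.reverse_prefix.2 hA) h
  rw [← List.reverse_prefix]
  simpa using this

/-- The words of length `q` in `L`. -/
def wordsOf (L : Set (List Bool)) (q : ℕ) : Set (List Bool) := {w | w.length = q ∧ w ∈ L}

theorem wordsOf_finite (L : Set (List Bool)) (q : ℕ) : (wordsOf L q).Finite :=
  (List.finite_length_eq Bool q).subset fun _ h => h.1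

/-- A word all of whose one-letter extensions to the right are in `L`. -/
def RightSpecial (L : Set (List Bool)) (w : List Bool) : Prop := ∀ b, w ++ [b] ∈ L

/-- A language closed under factors in which every word extends to the right. -/
structure IsExtendable (L : Set (List Bool)) : Prop where
  factor : ∀ {v w}, v <:+: w → w ∈ L → v ∈ L
  extend : ∀ w ∈ L, ∃ b, w ++ [b] ∈ L

namespace IsExtendable

variable {L : Set (List Bool)}

theorem rightSpecial_of_suffix (hL : IsExtendable L) {v w : List Bool} (h : v <:+ w)
    (hw : RightSpecial L w) :
    RightSpecial L v := by
  intro b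
  obtain ⟨p, rfl⟩ := h
  exact hL.factor ⟨p, [], by simp⟩ (hw b)

theorem ncard_add_card_le (hL : IsExtendable L) (q : ℕ) (T : Finset (List Bool))
    (hT : ∀ w ∈ T, w.length = q ∧ RightSpecial L w) :
    (wordsOf L q).ncard + T.card ≤ (wordsOf L (q + 1)).ncard := by
  classical
  have hc : ∀ w : List Bool, ∃ b, w ∈ L → w ++ [b] ∈ L := by
    intro w
    by_cases hw : w ∈ L
    · obtain ⟨b, hb⟩ := hL.extend w hw
      exact ⟨b, fun _ => hb⟩
    · exact ⟨true, fun h => absurd h hw⟩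
  choose c hc using hc
  have h1 : Function.Injective fun w : List Bool => w ++ [c w] := by
    intro v w h
    exact (List.append_inj' h rfl).1
  have h2 : Function.Injective fun w : List Bool => w ++ [!c w] := by
    intro v w h
    exact (List.append_inj' h rfl).1
  have hd : Disjoint ((fun w : List Bool => w ++ [c w]) '' wordsOf L q)
      ((fun w : List Bool => w ++ [!c w]) '' (T : Set (List Bool))) := by
    rw [Set.disjoint_left]
    rintro _ ⟨v, -, rfl⟩ ⟨w, -, h⟩
    obtain ⟨rfl, h⟩ := List.append_inj' h rfl
    simp at h
  have hsub : ((fun w : List Bool => w ++ [c w]) '' wordsOf L q) ∪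
      ((fun w : List Bool => w ++ [!c w]) '' (T : Set (List Bool))) ⊆ wordsOf L (q + 1) := by
    rintro _ (⟨v, hv, rfl⟩ | ⟨v, hv, rfl⟩)
    · exact ⟨by simp [hv.1], hc v hv.2⟩
    · exact ⟨by simp [(hT v hv).1], (hT v hv).2 _⟩
  have := Set.ncard_le_ncard hsub (wordsOf_finite L (q + 1))
  rwa [Set.ncard_union_eq hd ((wordsOf_finite L q).image _) (T.finite_toSet.image _),
    Set.ncard_image_of_injective _ h1, Set.ncard_image_of_injective _ h2,
    Set.ncard_coe_finset] at this

theorem ncard_add_one_le (hL : IsExtendable L) {q : ℕ} {w : List Bool}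
    (hw : RightSpecial L w) (hq : q ≤ w.length) :
    (wordsOf L q).ncard + 1 ≤ (wordsOf L (q + 1)).ncard := by
  have hs : w.drop (w.length - q) <:+ w := List.drop_suffix _ _
  simpa using hL.ncard_add_card_le q {w.drop (w.length - q)} (by
    simp only [Finset.mem_singleton, forall_eq]
    exact ⟨by simp; omega, hL.rightSpecial_of_suffix hs hw⟩)

theorem ncard_add_two_le (hL : IsExtendable L) {q : ℕ} {v w z : List Bool} {c c' : Bool}
    (hv : RightSpecial L v)
    (hw : RightSpecial L w) (hvz : c :: z <:+ v) (hwz : c' :: z <:+ w) (hc : c ≠ c')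
    (hz : z.length < q) (hqv : q ≤ v.length) (hqw : q ≤ w.length) :
    (wordsOf L q).ncard + 2 ≤ (wordsOf L (q + 1)).ncard := by
  have hs : v.drop (v.length - q) <:+ v := List.drop_suffix _ _
  have ht : w.drop (w.length - q) <:+ w := List.drop_suffix _ _
  have hsl : (v.drop (v.length - q)).length = q := by simp; omega
  have htl : (w.drop (w.length - q)).length = q := by simp; omega
  have hne : v.drop (v.length - q) ≠ w.drop (w.length - q) := by
    intro h
    have h1 := List.suffix_of_suffix_length_le hvz hs (by simp; omega)
    have h2 := List.suffix_of_suffix_length_le hwz ht (by simp; omega)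
    rw [h] at h1
    have h3 := (List.suffix_of_suffix_length_le h1 h2 (by simp)).eq_of_length (by simp)
    simp_all
  have := hL.ncard_add_card_le q {v.drop (v.length - q), w.drop (w.length - q)} (by
    intro u hu
    simp only [Finset.mem_insert, Finset.mem_singleton] at hu
    rcases hu with rfl | rfl
    · exact ⟨hsl, hL.rightSpecial_of_suffix hs hv⟩
    · exact ⟨htl, hL.rightSpecial_of_suffix ht hw⟩)
  rwa [Finset.card_pair hne] at this

theorem rightSpecial_spaced (hL : IsExtendable L) {A : List Bool} (hA : [false] <+: A)
    {e f : ℕ}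
    (hef : e < f) {t : List ℕ} (he : spaced A (t ++ [e]) ∈ L) (hf : spaced A (t ++ [f]) ∈ L) :
    RightSpecial L (spaced A t ++ List.replicate e true) := by
  rw [spaced_append] at he hf
  have h1 := (List.prefix_append_right_inj (spaced A t)).2
    (prefix_replicate_append hA (le_refl e))
  have h2 := (List.prefix_append_right_inj (spaced A t)).2
    (prefix_replicate_append hA hef.le)
  rw [← List.append_assoc] at h1 h2
  intro b
  cases b with
  | false => exact hL.factor (by simpa [spaced] using h1.isInfix) he
  | true => exact hL.factor (by simpa [spaced, hef] using h2.isInfix) hf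

end IsExtendable

theorem add_mul_sub_le_of_step {p : ℕ → ℕ} {k a b : ℕ} (hab : a ≤ b)
    (h : ∀ l, a ≤ l → l < b → p l + k ≤ p (l + 1)) : p a + k * (b - a) ≤ p b := by
  induction b, hab using Nat.le_induction with
  | base => simp
  | succ n hn ih =>
    have h1 := ih fun l h1 h2 => h l h1 (h2.trans n.lt_succ_self)
    have h2 := h n hn n.lt_succ_self
    rw [Nat.succ_sub hn, Nat.mul_succ]
    omega

/-- The word of length `q` read off from the sequence `u` at position `i`. -/
def window (u : ℕ → Bool) (i q : ℕ) : List Bool := (List.range q).map fun t => u (i + t)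

theorem window_length (u : ℕ → Bool) (i q : ℕ) : (window u i q).length = q := by
  simp [window]

theorem window_eq_window_iff {u v : ℕ → Bool} {i j q : ℕ} :
    window u i q = window v j q ↔ ∀ t < q, u (i + t) = v (j + t) := by
  simp [window]

theorem window_add (u : ℕ → Bool) (i q q' : ℕ) :
    window u i (q + q') = window u i q ++ window u (i + q) q' := by
  simp [window, List.range_add, Function.comp_def, add_assoc]

theorem infix_window (u : ℕ → Bool) {i q n : ℕ} (h : i + q ≤ n) :
    window u i q <:+: window u 0 n := by
  obtain ⟨k, rfl⟩ := Nat.exists_eq_add_of_le h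
  refine ⟨window u 0 i, window u (i + q) k, ?_⟩
  simp [window_add]

theorem window_getD (w : List Bool) : window (fun t => w.getD t false) 0 w.length = w := by
  apply List.ext_getElem
  · simp [window]
  · intro n h1 h2
    simp [window, h2]

section Gap

variable (A R : List Bool) (g : ℕ)

theorem getD_gap_left {t : ℕ} (h : t < A.length) :
    (A ++ (List.replicate g true ++ R)).getD t false = A.getD t false := by
  rw [List.getD_append _ _ _ _ h]

theorem getD_gap_mid {t : ℕ} (h : t < g) :
    (A ++ (List.replicate g true ++ R)).getD (A.length + t) false = true := by
  rw [List.getD_append_right _ _ _ _ (by omega), List.getD_append _ _ _ _ (by simpa using h)]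
  simp [h]

theorem getD_gap_right (t : ℕ) :
    (A ++ (List.replicate g true ++ R)).getD (A.length + g + t) false = R.getD t false := by
  rw [List.getD_append_right _ _ _ _ (by omega),
    List.getD_append_right _ _ _ _ (by simp; omega)]
  congr 1
  simp
  omega

end Gap

/-- The letters of a word `A 1^α A 1^β A 1^α A`, where `A` is the word of length `x` read off
from `a`, and `A` starts and ends with a zero. -/
structure IsSpacedTriple (x α β : ℕ) (a u : ℕ → Bool) : Prop where
  pos : 0 < x
  first : a 0 = false
  last : a (x - 1) = false
  word₁ : ∀ t < x, u t = a t
  gap₁ : ∀ t < α, u (x + t) = true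
  word₂ : ∀ t < x, u (x + α + t) = a t
  gap₂ : ∀ t < β, u (2 * x + α + t) = true
  word₃ : ∀ t < x, u (2 * x + α + β + t) = a t
  gap₃ : ∀ t < α, u (3 * x + α + β + t) = true
  word₄ : ∀ t < x, u (3 * x + 2 * α + β + t) = a t

theorem isSpacedTriple_getD {A : List Bool} (h0 : [false] <+: A) (h1 : [false] <:+ A)
    (α β : ℕ) : IsSpacedTriple A.length α β (fun t => A.getD t false)
      (fun t => (spaced A [α, β, α]).getD t false) where
  pos := h0.length_le
  first := by obtain ⟨B, rfl⟩ := h0; rfl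
  last := by obtain ⟨B, rfl⟩ := h1; simp
  word₁ t ht := getD_gap_left _ _ _ ht
  gap₁ t ht := getD_gap_mid _ _ _ ht
  word₂ t ht := by
    simp only [spaced]
    rw [getD_gap_right, getD_gap_left _ _ _ ht]
  gap₂ t ht := by
    simp only [spaced]
    rw [show 2 * A.length + α + t = A.length + α + (A.length + t) by ring, getD_gap_right,
      getD_gap_mid _ _ _ ht]
  word₃ t ht := by
    simp only [spaced]
    rw [show 2 * A.length + α + β + t = A.length + α + (A.length + β + t) by ring,
      getD_gap_right, getD_gap_right, getD_gap_left _ _ _ ht]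
  gap₃ t ht := by
    simp only [spaced]
    rw [show 3 * A.length + α + β + t = A.length + α + (A.length + β + (A.length + t)) by ring,
      getD_gap_right, getD_gap_right, getD_gap_mid _ _ _ ht]
  word₄ t ht := by
    simp only [spaced]
    rw [show 3 * A.length + 2 * α + β + t =
        A.length + α + (A.length + β + (A.length + α + t)) by ring,
      getD_gap_right, getD_gap_right, getD_gap_right]

namespace IsSpacedTriple

variable {x α β : ℕ} {a u : ℕ → Bool}

theorem shift_left (h : IsSpacedTriple x α β a u) {s : ℕ} (hs : s < x + min α β) :
    u s = u (s + (x + α)) := by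
  by_cases h1 : s < x
  · rw [h.word₁ s h1, show s + (x + α) = x + α + s by ring, h.word₂ s h1]
  · have h2 := h.gap₁ (s - x) (by omega)
    have h3 := h.gap₂ (s - x) (by omega)
    rw [show s = x + (s - x) by omega, h2, ← h3]
    congr 1; omega

theorem shift_right (h : IsSpacedTriple x α β a u) {s : ℕ} (hs : 2 * x + max α β ≤ s)
    (hs' : s < 3 * x + α + β) : u s = u (s + (x + α)) := by
  by_cases h1 : s < 2 * x + α + β
  · have h2 := h.gap₂ (s - (2 * x + α)) (by omega)
    have h3 := h.gap₃ (s + (x + α) - (3 * x + α + β)) (by omega)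
    rw [show s = 2 * x + α + (s - (2 * x + α)) by omega, h2, ← h3]
    congr 1; omega
  · have h2 := h.word₃ (s - (2 * x + α + β)) (by omega)
    have h3 := h.word₄ (s - (2 * x + α + β)) (by omega)
    rw [show s = 2 * x + α + β + (s - (2 * x + α + β)) by omega, h2, ← h3]
    congr 1; omega

theorem shift_mid (h : IsSpacedTriple x α β a u) {s : ℕ} (hs : x + α ≤ s + min α β)
    (hs' : s < 2 * x + α + min α β) : u s = u (s + (x + β)) := by
  by_cases h1 : s < x + α
  · have h2 := h.gap₁ (s - x) (by omega)
    have h3 := h.gap₂ (s + (x + β) - (2 * x + α)) (by omega)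
    rw [show s = x + (s - x) by omega, h2, ← h3]
    congr 1; omega
  · by_cases h4 : s < 2 * x + α
    · have h2 := h.word₂ (s - (x + α)) (by omega)
      have h3 := h.word₃ (s - (x + α)) (by omega)
      rw [show s = x + α + (s - (x + α)) by omega, h2, ← h3]
      congr 1; omega
    · have h2 := h.gap₂ (s - (2 * x + α)) (by omega)
      have h3 := h.gap₃ (s - (2 * x + α)) (by omega)
      rw [show s = 2 * x + α + (s - (2 * x + α)) by omega, h2, ← h3]
      congr 1; omega

theorem break_left (h : IsSpacedTriple x α β a u) (hαβ : α ≠ β) :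
    u (x + min α β) ≠ u (x + min α β + (x + α)) := by
  have hx := h.pos
  rcases hαβ.lt_or_gt with hlt | hlt
  · have h1 := h.word₂ 0 hx
    have h2 := h.gap₂ α hlt
    rw [min_eq_left hlt.le, show x + α + (x + α) = 2 * x + α + α by ring, h2]
    rw [add_zero, h.first] at h1
    simp [h1]
  · have h1 := h.gap₁ β hlt
    have h2 := h.word₃ 0 hx
    rw [min_eq_right hlt.le, show x + β + (x + α) = 2 * x + α + β + 0 by ring, h2, h1, h.first]
    simp

theorem break_right (h : IsSpacedTriple x α β a u) (hαβ : α ≠ β) :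
    u (2 * x + max α β - 1) ≠ u (2 * x + max α β - 1 + (x + α)) := by
  have hx := h.pos
  rcases hαβ.lt_or_gt with hlt | hlt
  · have h1 := h.gap₂ (β - 1 - α) (by omega)
    have h2 := h.word₃ (x - 1) (by omega)
    rw [max_eq_right hlt.le, show 2 * x + β - 1 = 2 * x + α + (β - 1 - α) by omega, h1,
      show 2 * x + α + (β - 1 - α) + (x + α) = 2 * x + α + β + (x - 1) by omega, h2, h.last]
    simp
  · have h1 := h.word₂ (x - 1) (by omega)
    have h2 := h.gap₃ (α - 1 - β) (by omega)
    rw [max_eq_left hlt.le, show 2 * x + α - 1 = x + α + (x - 1) by omega, h1,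
      show x + α + (x - 1) + (x + α) = 3 * x + α + β + (α - 1 - β) by omega, h2, h.last]
    simp

theorem break_mid (h : IsSpacedTriple x α β a u) (hαβ : α ≠ β) :
    u (x + α - 1 - min α β) ≠ u (x + α - 1 - min α β + (x + β)) := by
  have hx := h.pos
  rcases hαβ.lt_or_gt with hlt | hlt
  · have h1 := h.word₁ (x - 1) (by omega)
    have h2 := h.gap₂ (β - 1 - α) (by omega)
    rw [min_eq_left hlt.le, show x + α - 1 - α = x - 1 by omega, h1, h.last,
      show x - 1 + (x + β) = 2 * x + α + (β - 1 - α) by omega, h2]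
    simp
  · have h1 := h.gap₁ (α - 1 - β) (by omega)
    have h2 := h.word₂ (x - 1) (by omega)
    rw [min_eq_right hlt.le, show x + α - 1 - β = x + (α - 1 - β) by omega, h1,
      show x + (α - 1 - β) + (x + β) = x + α + (x - 1) by omega, h2, h.last]
    simp

theorem window_ne_window (h : IsSpacedTriple x α β a u) (hαβ : α ≠ β) {i j : ℕ}
    (hi : max α β ≤ i) (hi' : i < x) (hj : x + max α β ≤ j)
    (hj' : j < 2 * x + max α β) :
    window u i (2 * x + α) ≠ window u j (2 * x + α) := by
  rw [Ne, window_eq_window_iff]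
  intro H
  obtain ⟨δ, rfl⟩ := Nat.exists_eq_add_of_le (show i ≤ j by omega)
  have H' : ∀ s, i ≤ s → s < i + (2 * x + α) → u s = u (s + δ) := by
    intro s h1 h2
    have := H (s - i) (by omega)
    rw [show i + (s - i) = s by omega] at this
    rw [this]
    congr 1; omega
  have hx := h.pos
  by_cases h1 : δ ≤ x + min α β
  · apply h.break_mid hαβ
    rw [H' _ (by omega) (by omega), h.shift_mid (by omega) (by omega),
      H' (x + α - 1 - min α β + (x + β)) (by omega) (by omega)]
    congr 1; omega
  · by_cases h2 : δ < x + max α β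
    · rcases hαβ.lt_or_gt with hlt | hlt
      · have h3 := H' (x + α + 0) (by omega) (by omega)
        rw [h.word₂ 0 hx, h.first] at h3
        have h4 := h.gap₂ (δ - x) (by omega)
        rw [show x + α + 0 + δ = 2 * x + α + (δ - x) by omega, h4] at h3
        simp at h3
      · have h3 := H' (2 * x + α + β + 0 - δ) (by omega) (by omega)
        rw [show 2 * x + α + β + 0 - δ + δ = 2 * x + α + β + 0 by omega, h.word₃ 0 hx,
          h.first] at h3
        have h4 := h.gap₁ (x + α + β - δ) (by omega)
        rw [show 2 * x + α + β + 0 - δ = x + (x + α + β - δ) by omega, h4] at h3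
        simp at h3
    · apply h.break_left hαβ
      rw [H' _ (by omega) (by omega), H' (x + min α β + (x + α)) (by omega) (by omega),
        h.shift_right (by omega) (by omega)]
      congr 1; omega

theorem window_left_ne (h : IsSpacedTriple x α β a u) (hαβ : α ≠ β) {i j : ℕ} (hij : i < j)
    (hi : max α β ≤ i) (hj : j < x) :
    window u i (2 * x + α) ≠ window u j (2 * x + α) := by
  rw [Ne, window_eq_window_iff]
  intro H
  have h1 := H (x + min α β - j) (by omega)
  have h2 := H (x + min α β - j + (x + α)) (by omega)
  have h3 := h.shift_left (s := i + (x + min α β - j)) (by omega)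
  rw [add_assoc] at h3
  apply h.break_left hαβ
  convert h1.symm.trans (h3.trans h2) using 2 <;> omega

theorem window_right_ne (h : IsSpacedTriple x α β a u) (hαβ : α ≠ β) {i j : ℕ} (hij : i < j)
    (hi : x + max α β ≤ i) (hj : j < 2 * x + max α β) :
    window u i (2 * x + α) ≠ window u j (2 * x + α) := by
  rw [Ne, window_eq_window_iff]
  intro H
  have h1 := H (2 * x + max α β - 1 - i) (by omega)
  have h2 := H (2 * x + max α β - 1 - i + (x + α)) (by omega)
  have h3 := h.shift_right (s := j + (2 * x + max α β - 1 - i)) (by omega) (by omega)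
  rw [add_assoc] at h3
  apply h.break_right hαβ
  convert h1.trans (h3.trans h2.symm) using 2 <;> omega

theorem window_left_ne_periodic (h : IsSpacedTriple x α β a u) (hαβ : α ≠ β) {f : ℕ → Bool}
    (hf : ∀ t, f (t + (x + α)) = f t) {i j : ℕ} (hi : max α β ≤ i) (hi' : i < x) :
    window u i (2 * x + α) ≠ window f j (2 * x + α) := by
  rw [Ne, window_eq_window_iff]
  intro H
  have h1 := H (x + min α β - i) (by omega)
  have h2 := H (x + min α β - i + (x + α)) (by omega)
  apply h.break_left hαβ
  rw [← add_assoc, ← add_assoc j, hf, ← h1] at h2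
  convert h2.symm using 2 <;> omega

theorem window_right_ne_periodic (h : IsSpacedTriple x α β a u) (hαβ : α ≠ β) {f : ℕ → Bool}
    (hf : ∀ t, f (t + (x + α)) = f t) {i j : ℕ} (hi : x + max α β ≤ i)
    (hi' : i < 2 * x + max α β) :
    window u i (2 * x + α) ≠ window f j (2 * x + α) := by
  rw [Ne, window_eq_window_iff]
  intro H
  have h1 := H (2 * x + max α β - 1 - i) (by omega)
  have h2 := H (2 * x + max α β - 1 - i + (x + α)) (by omega)
  apply h.break_right hαβ
  rw [← add_assoc, ← add_assoc j, hf, ← h1] at h2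
  convert h2.symm using 2 <;> omega

end IsSpacedTriple

theorem window_ne_of_periodic {f : ℕ → Bool} {γ : ℕ} (hγ : 0 < γ) (hf : Function.Periodic f γ)
    {i j q : ℕ} (hq : γ ≤ q) (hij : i < j) (hp : ¬ Function.Periodic f (j - i)) :
    window f i q ≠ window f j q := by
  rw [Ne, window_eq_window_iff]
  intro H
  apply hp
  have hH : ∀ t, f (i + t) = f (j + t) := by
    intro t
    have h1 := H (t % γ) ((Nat.mod_lt _ hγ).trans_le hq)
    rw [← hf.map_mod_nat (i + t), ← hf.map_mod_nat (j + t)]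
    rwa [← hf.map_mod_nat (i + t % γ), ← hf.map_mod_nat (j + t % γ), Nat.add_mod_mod,
      Nat.add_mod_mod] at h1
  intro t
  have hg := hf.nat_mul i
  have hi : i ≤ i * γ := Nat.le_mul_of_pos_right i hγ
  rw [← hg t, ← hg (t + (j - i))]
  have h1 := hH (t + i * γ - i)
  rw [Nat.cast_id]
  convert h1.symm using 2 <;> omega

theorem IsSpacedTriple.le_ncard_wordsOf {L : Set (List Bool)}
    (hL : ∀ {v w}, v <:+: w → w ∈ L → v ∈ L) {x α β : ℕ} {a u : ℕ → Bool}
    (h : IsSpacedTriple x α β a u) (hαβ : α ≠ β) (hu : window u 0 (4 * x + 2 * α + β) ∈ L)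
    {f : ℕ → Bool} (hf : Function.Periodic f (x + α)) (hfL : window f 0 (3 * x + 2 * α) ∈ L)
    {p : ℕ} (hp : p ≤ x + α) (hmin : ∀ k, 0 < k → k < p → ¬ Function.Periodic f k) :
    p + (x - max α β) + x ≤ (wordsOf L (2 * x + α)).ncard := by
  classical
  have hx := h.pos
  set q := 2 * x + α with hq
  let P := (Finset.range p).image fun i => window f i q
  let S := (Finset.Ico (max α β) x).image fun i => window u i q
  let T := (Finset.Ico (x + max α β) (2 * x + max α β)).image fun i => window u i q
  have hP : P.card = p := by
    rw [Finset.card_image_of_injOn, Finset.card_range]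
    intro i hi j hj hij
    simp only [Finset.coe_range, Set.mem_Iio] at hi hj
    by_contra hne
    rcases Nat.lt_or_gt_of_ne hne with hlt | hlt
    · exact window_ne_of_periodic (by omega) hf (by omega) hlt
        (hmin _ (by omega) (by omega)) hij
    · exact window_ne_of_periodic (by omega) hf (by omega) hlt
        (hmin _ (by omega) (by omega)) hij.symm
  have hS : S.card = x - max α β := by
    rw [Finset.card_image_of_injOn, Nat.card_Ico]
    intro i hi j hj hij
    simp only [Finset.coe_Ico, Set.mem_Ico] at hi hj
    by_contra hne
    rcases Nat.lt_or_gt_of_ne hne with hlt | hlt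
    · exact h.window_left_ne hαβ hlt hi.1 hj.2 hij
    · exact h.window_left_ne hαβ hlt hj.1 hi.2 hij.symm
  have hT : T.card = x := by
    rw [Finset.card_image_of_injOn, Nat.card_Ico]
    · omega
    intro i hi j hj hij
    simp only [Finset.coe_Ico, Set.mem_Ico] at hi hj
    by_contra hne
    rcases Nat.lt_or_gt_of_ne hne with hlt | hlt
    · exact h.window_right_ne hαβ hlt hi.1 hj.2 hij
    · exact h.window_right_ne hαβ hlt hj.1 hi.2 hij.symm
  have hPS : Disjoint P S := by
    rw [Finset.disjoint_left]
    intro w hw hw'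
    obtain ⟨i, -, rfl⟩ := Finset.mem_image.1 hw
    obtain ⟨j, hj, hij⟩ := Finset.mem_image.1 hw'
    rw [Finset.mem_Ico] at hj
    exact h.window_left_ne_periodic hαβ hf hj.1 hj.2 hij
  have hPST : Disjoint (P ∪ S) T := by
    rw [Finset.disjoint_left]
    intro w hw hw'
    obtain ⟨j, hj, rfl⟩ := Finset.mem_image.1 hw'
    rw [Finset.mem_Ico] at hj
    rcases Finset.mem_union.1 hw with hw | hw
    · obtain ⟨i, -, hi⟩ := Finset.mem_image.1 hw
      exact h.window_right_ne_periodic hαβ hf hj.1 hj.2 hi.symm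
    · obtain ⟨i, hi, hij⟩ := Finset.mem_image.1 hw
      rw [Finset.mem_Ico] at hi
      exact h.window_ne_window hαβ hi.1 hi.2 hj.1 hj.2 hij
  have hsub : ((P ∪ S ∪ T : Finset (List Bool)) : Set (List Bool)) ⊆ wordsOf L q := by
    intro w hw
    simp only [Finset.coe_union, Set.mem_union, Finset.mem_coe] at hw
    rcases hw with (hw | hw) | hw
    · obtain ⟨i, hi, rfl⟩ := Finset.mem_image.1 hw
      rw [Finset.mem_range] at hi
      exact ⟨window_length _ _ _, hL (infix_window f (by omega)) hfL⟩
    · obtain ⟨i, hi, rfl⟩ := Finset.mem_image.1 hw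
      rw [Finset.mem_Ico] at hi
      exact ⟨window_length _ _ _, hL (infix_window u (by omega)) hu⟩
    · obtain ⟨i, hi, rfl⟩ := Finset.mem_image.1 hw
      rw [Finset.mem_Ico] at hi
      exact ⟨window_length _ _ _, hL (infix_window u (by omega)) hu⟩
  have := Set.ncard_le_ncard hsub (wordsOf_finite L q)
  rwa [Set.ncard_coe_finset, Finset.card_union_of_disjoint hPST,
    Finset.card_union_of_disjoint hPS, hP, hS, hT] at this

/-- The periodic sequence `A 1^g A 1^g ⋯`. -/
def periodicSeq (A : List Bool) (g : ℕ) (t : ℕ) : Bool :=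
  (A ++ List.replicate g true).getD (t % (A.length + g)) false

theorem periodicSeq_periodic (A : List Bool) (g : ℕ) :
    Function.Periodic (periodicSeq A g) (A.length + g) := by
  intro t
  simp [periodicSeq]

theorem window_periodicSeq (A : List Bool) (g m : ℕ) {j : ℕ} (hj : j ≤ g) :
    window (periodicSeq A g) 0 ((spaced A (List.replicate m g)).length + j) =
      spaced A (List.replicate m g) ++ List.replicate j true := by
  have key : ∀ k ≤ g, window (periodicSeq A g) 0 (A.length + k) =
      A ++ List.replicate k true := by
    intro k hk
    apply List.ext_getElem
    · simp [window]
    · intro n h1 h2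
      rw [window_length] at h1
      simp only [window, List.getElem_map, List.getElem_range, periodicSeq, zero_add]
      rw [Nat.mod_eq_of_lt (by omega), List.getD_eq_getElem _ _ (by simp; omega)]
      simp only [List.getElem_append, List.getElem_replicate]
  induction m with
  | zero => exact key j hj
  | succ m ih =>
    have h1 : (spaced A (List.replicate (m + 1) g)).length + j =
        A.length + g + ((spaced A (List.replicate m g)).length + j) := by
      simp [List.replicate_succ, spaced]; ring
    have h2 : window (periodicSeq A g) (0 + (A.length + g))
        ((spaced A (List.replicate m g)).length + j) = window (periodicSeq A g) 0
        ((spaced A (List.replicate m g)).length + j) := by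
      rw [window_eq_window_iff]
      intro t _
      rw [zero_add, zero_add, add_comm, periodicSeq_periodic]
    rw [h1, window_add, h2, ih, key g le_rfl, List.replicate_succ, spaced]
    simp

theorem exists_eq_window {f : ℕ → Bool} {n : ℕ} {v : List Bool}
    (h : v <:+: window f 0 n) : ∃ i, v = window f i v.length := by
  obtain ⟨p, q, h⟩ := h
  have hn : n = p.length + v.length + q.length := by
    rw [← window_length f 0 n, ← h]; simp [add_assoc]
  rw [hn, window_add, window_add] at h
  have h1 := (List.append_inj h (by simp [window_length])).1
  exact ⟨0 + p.length, (List.append_inj h1 (by simp [window_length])).2⟩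

theorem Function.Periodic.lt_of_branching {f : ℕ → Bool} {p n : ℕ} (hf : Function.Periodic f p)
    (hp : 0 < p) {U : List Bool} (h0 : U ++ [false] <:+: window f 0 n)
    (h1 : U ++ [true] <:+: window f 0 n) : U.length < p := by
  obtain ⟨i, hi⟩ := exists_eq_window h0
  obtain ⟨j, hj⟩ := exists_eq_window h1
  simp only [List.length_append, List.length_singleton, window_add] at hi hj
  obtain ⟨hi, hi'⟩ := List.append_inj hi (by simp [window_length])
  obtain ⟨hj, hj'⟩ := List.append_inj hj (by simp [window_length])
  simp only [window, List.range_one, List.map_cons, List.map_nil, List.cons.injEq, add_zero,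
    and_true] at hi' hj'
  by_contra! hle
  have h2 := window_eq_window_iff.1 (hi.symm.trans hj) (U.length - p) (by omega)
  rw [← hf (i + _), ← hf (j + _), add_assoc, add_assoc, Nat.sub_add_cancel hle, ← hi',
    ← hj'] at h2
  simp at h2

/-- The right special words given by a long run of the gap `α` ended by the gap `β`. -/
theorem rightSpecial_window_periodicSeq {L : Set (List Bool)} (hL : IsExtendable L)
    {A : List Bool} (h0 : [false] <+: A) {α β M p : ℕ} (hαβ : α ≠ β)
    (hrun : spaced A (List.replicate M α ++ [β]) ∈ L)
    (hf : Function.Periodic (periodicSeq A α) p) (hp : 0 < p)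
    (hpM : p ≤ (spaced A (List.replicate M α)).length + min α β) :
    RightSpecial L (window (periodicSeq A α) 0
      ((spaced A (List.replicate M α)).length + min α β - p)) := by
  set f := periodicSeq A α with hfdef
  set l := (spaced A (List.replicate M α)).length + min α β with hl
  have hW := window_periodicSeq A α M (min_le_left α β)
  rw [← hfdef, ← hl] at hW
  have hpre : window f 0 l ++ [decide (min α β < β)] ∈ L := by
    refine hL.factor ?_ hrun
    have := (List.prefix_append_right_inj (spaced A (List.replicate M α))).2
      (prefix_replicate_append h0 (min_le_right α β))
    rw [hW, spaced_append]
    simpa [spaced] using this.isInfix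
  have hfl : f (l - p) = decide (min α β < α) := by
    rw [← hf (l - p), Nat.sub_add_cancel hpM]
    rcases hαβ.lt_or_gt with hlt | hlt
    · have h1 := spaced_replicate_length A α M
      have h2 := (periodicSeq_periodic A α).nat_mul_eq (M + 1)
      rw [Nat.cast_id, ← h1] at h2
      rw [min_eq_left hlt.le] at hl
      rw [hl, min_eq_left hlt.le, hfdef, h2]
      obtain ⟨B, rfl⟩ := h0
      simp [periodicSeq]
    · rw [min_eq_right hlt.le] at hl hW ⊢
      have h1 := window_periodicSeq A α M (j := β + 1) hlt
      rw [← hfdef, ← add_assoc, ← hl, window_add, hW, List.replicate_succ',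
        ← List.append_assoc] at h1
      have h2 := (List.append_inj h1 (by simp)).2
      simp [window] at h2
      simp [h2, hlt]
  have hb : ∀ b, b = decide (min α β < α) ∨ b = decide (min α β < β) := by
    intro b
    rcases hαβ.lt_or_gt with hlt | hlt
    · cases b <;> simp [hlt, hlt.le]
    · cases b <;> simp [hlt, hlt.le]
  intro b
  rcases hb b with hb | hb
  · have h1 : window f 0 (l - p) ++ [b] = window f 0 (l - p + 1) := by
      rw [window_add, hb, ← hfl]
      simp [window]
    rw [h1]
    exact hL.factor (infix_window f (by omega)) (hL.factor ⟨[], _, rfl⟩ hpre)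
  · rw [hb]
    refine hL.factor ?_ hpre
    have h1 : window f 0 l = window f 0 p ++ window f 0 (l - p) := by
      have h2 := window_add f 0 p (l - p)
      rw [Nat.add_sub_cancel' hpM] at h2
      rw [h2]
      congr 1
      rw [window_eq_window_iff]
      intro t _
      rw [zero_add, zero_add, add_comm, hf]
    rw [h1, List.append_assoc]
    exact List.infix_append_right

/-- If the gap `β` is isolated, then the complexity exceeds `3 / 2 q` by a quantity controlled by
the length of a word which has two different continuations inside `A`. -/
theorem exists_large_complexity_of_isolated {L : Set (List Bool)} (hL : IsExtendable L)
    {A : List Bool} (h0 : [false] <+: A) (h1 : [false] <:+ A) {α β m M : ℕ} (hαβ : α ≠ β)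
    (hm : 1 ≤ m) (hM : 2 * m + 1 ≤ M) (hx : max α β < A.length)
    (haa : spaced A [α, α] ∈ L) (haba : spaced A [α, β, α] ∈ L)
    (hrun : spaced A (List.replicate M α ++ [β]) ∈ L)
    (hmain : ∀ k : ℕ, ∃ w, k ≤ w.length ∧ RightSpecial L w ∧
      spaced A (β :: List.replicate m α) ++ List.replicate (min α β) true <:+ w)
    {U : List Bool} (hU0 : U ++ [false] <:+: A) (hU1 : U ++ [true] <:+: A) :
    ∃ q, A.length ≤ q ∧
      3 * q + U.length ≤ 2 * (wordsOf L q).ncard + (10 * max α β + 10) := by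
  classical
  set f := periodicSeq A α with hfdef
  have hf : Function.Periodic f (A.length + α) := periodicSeq_periodic A α
  have hex : ∃ p, 0 < p ∧ Function.Periodic f p := ⟨A.length + α, by omega, hf⟩
  obtain ⟨hp0, hp⟩ := Nat.find_spec hex
  have hmin : ∀ k, 0 < k → k < Nat.find hex → ¬ Function.Periodic f k :=
    fun k hk hk' h => Nat.find_min hex hk' ⟨hk, h⟩
  have hple : Nat.find hex ≤ A.length + α := Nat.find_min' hex ⟨by omega, hf⟩
  set p := Nat.find hex
  have hAf : A = window f 0 A.length := by
    simpa [spaced] using (window_periodicSeq A α 0 (Nat.zero_le α)).symm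
  rw [hAf] at hU0 hU1
  have hUp := hp.lt_of_branching hp0 hU0 hU1
  have hcount : p + (A.length - max α β) + A.length ≤ (wordsOf L (2 * A.length + α)).ncard := by
    refine (isSpacedTriple_getD h0 h1 α β).le_ncard_wordsOf hL.factor hαβ ?_ hf ?_ hple hmin
    · have h2 := window_getD (spaced A [α, β, α])
      have h3 : (spaced A [α, β, α]).length = 4 * A.length + 2 * α + β := by
        simp [spaced]; ring
      rw [h3] at h2
      rwa [h2]
    · have h2 := window_periodicSeq A α 2 (Nat.zero_le α)
      have h3 : (spaced A (List.replicate 2 α)).length = 3 * A.length + 2 * α := by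
        simp [spaced, List.replicate_succ]; ring
      rw [h3] at h2
      rw [hfdef, ← add_zero (3 * A.length + 2 * α), h2]
      simpa [List.replicate_succ] using haa
  have hlM := spaced_replicate_length A α M
  have hlm := spaced_replicate_length A α m
  have hTM : 2 * ((m + 1) * (A.length + α)) ≤ (M + 1) * (A.length + α) := by
    rw [← mul_assoc]
    exact Nat.mul_le_mul_right _ (by omega)
  have hTm : 2 * (A.length + α) ≤ (m + 1) * (A.length + α) :=
    Nat.mul_le_mul_right _ (by omega)
  have hRS := rightSpecial_window_periodicSeq hL h0 hαβ hrun hp hp0 (by omega)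
  set q := (spaced A (List.replicate M α)).length + min α β - p with hq
  set z := List.replicate (min α β) true ++
    (spaced A (List.replicate m α) ++ List.replicate (min α β) true) with hz
  have hzl : z.length = (spaced A (List.replicate m α)).length + 2 * min α β := by
    simp [hz]; ring
  have hzq : z.length + 1 ≤ q := by omega
  have hzV : decide (min α β < α) :: z <:+ window f 0 q := by
    have hsuf : window f 0 q <:+ spaced A (List.replicate M α) ++
        List.replicate (min α β) true := by
      rw [← window_periodicSeq A α M (min_le_left α β)]
      have h2 := window_add f 0 p q
      rw [show p + q = (spaced A (List.replicate M α)).length + min α β by omega] at h2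
      rw [← hfdef, h2]
      have h3 : window f (0 + p) q = window f 0 q := by
        rw [window_eq_window_iff]
        intro t _
        rw [zero_add, zero_add, add_comm, hp]
      rw [h3]
      exact List.suffix_append _ _
    refine List.suffix_of_suffix_length_le ?_ hsuf (by rw [window_length]; simpa using hzq)
    obtain ⟨k, hk⟩ := Nat.exists_eq_add_of_le (show m + 1 ≤ M by omega)
    have h2 : List.replicate M α = List.replicate k α ++ α :: List.replicate m α := by
      rw [← List.replicate_succ, ← List.replicate_add, hk]
      congr 1; omega
    obtain ⟨B, hB⟩ := suffix_append_replicate (h1.trans (suffix_spaced A (List.replicate k α)))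
      (min_le_left α β)
    refine ⟨B, ?_⟩
    rw [h2, spaced_append, ← List.append_assoc (spaced A (List.replicate k α)), ← hB]
    simp [hz]
  have hzW : decide (min α β < β) :: z <:+
      spaced A (β :: List.replicate m α) ++ List.replicate (min α β) true := by
    obtain ⟨B, hB⟩ := suffix_append_replicate h1 (min_le_right α β)
    refine ⟨B, ?_⟩
    rw [spaced, ← List.append_assoc A, ← hB]
    simp [hz]
  have hne : decide (min α β < α) ≠ decide (min α β < β) := by
    rcases hαβ.lt_or_gt with hlt | hlt <;> simp [hlt, hlt.le]
  have hone : (wordsOf L (2 * A.length + α)).ncard + 1 * (z.length + 1 - (2 * A.length + α)) ≤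
      (wordsOf L (z.length + 1)).ncard := by
    refine add_mul_sub_le_of_step (p := fun l => (wordsOf L l).ncard) (by omega) ?_
    intro l _ _
    obtain ⟨w, hlw, hw, -⟩ := hmain l
    exact hL.ncard_add_one_le hw hlw
  have htwo : (wordsOf L (z.length + 1)).ncard + 2 * (q - (z.length + 1)) ≤
      (wordsOf L q).ncard := by
    refine add_mul_sub_le_of_step (p := fun l => (wordsOf L l).ncard) hzq ?_
    intro l h2 h3
    obtain ⟨w, hlw, hw, hsw⟩ := hmain l
    exact hL.ncard_add_two_le hRS hw hzV (hzW.trans hsw) hne (by omega)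
      (by rw [window_length]; omega) hlw
  exact ⟨q, by omega, by omega⟩

/-- A rank-one language generated by words `A n`, starting and ending with a zero, which are
concatenated with gaps of the two lengths `e < f` only. -/
structure IsTwoGap (L : Set (List Bool)) (e f : ℕ) (A : ℕ → List Bool) (G : ℕ → List ℕ) :
    Prop where
  extendable : IsExtendable L
  extend_left : ∀ w ∈ L, ∃ b, b :: w ∈ L
  mem : ∀ n, A n ∈ L
  head : ∀ n, [false] <+: A n
  last : ∀ n, [false] <:+ A n
  succ : ∀ n, A (n + 1) = spaced (A n) (G n)
  gap : ∀ n, ∀ g ∈ G n, g = e ∨ g = f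
  short_mem : ∀ n, e ∈ G n
  long_mem : ∀ n, f ∈ G n
  lt : e < f

theorem ncard_wordsOf_reverse (L : Set (List Bool)) (q : ℕ) :
    (wordsOf {w | w.reverse ∈ L} q).ncard = (wordsOf L q).ncard := by
  rw [← Set.ncard_image_of_injective (wordsOf L q) List.reverse_injective]
  congr 1
  ext w
  constructor
  · rintro ⟨h1, h2⟩
    exact ⟨w.reverse, ⟨by simpa using h1, h2⟩, by simp⟩
  · rintro ⟨v, ⟨h1, h2⟩, rfl⟩
    exact ⟨by simpa using h1, by simpa using h2⟩

theorem exists_eq_replicate_append_cons {α β : ℕ} {G : List ℕ} (hG : ∀ g ∈ G, g = α ∨ g = β)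
    (hβ : β ∈ G) : ∃ a t, G = List.replicate a α ++ β :: t := by
  induction G with
  | nil => simp at hβ
  | cons g G ih =>
    by_cases hg : g = β
    · exact ⟨0, G, by simp [hg]⟩
    · obtain ⟨a, t, rfl⟩ := ih (fun x hx => hG x (by simp [hx]))
        ((List.mem_cons.1 hβ).resolve_left fun h => hg h.symm)
      exact ⟨a + 1, t, by simp [List.replicate_succ, (hG g (by simp)).resolve_right hg]⟩

theorem exists_eq_append_cons_replicate {α β : ℕ} {G : List ℕ} (hG : ∀ g ∈ G, g = α ∨ g = β)
    (hβ : β ∈ G) : ∃ t b, G = t ++ β :: List.replicate b α := by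
  obtain ⟨b, t, ht⟩ := exists_eq_replicate_append_cons (G := G.reverse)
    (fun g hg => hG g (List.mem_reverse.1 hg)) (List.mem_reverse.2 hβ)
  exact ⟨t.reverse, b, by simpa using congrArg List.reverse ht⟩

namespace IsTwoGap

variable {L : Set (List Bool)} {e f : ℕ} {A : ℕ → List Bool} {G : ℕ → List ℕ}

theorem reverse (h : IsTwoGap L e f A G) :
    IsTwoGap {w | w.reverse ∈ L} e f (fun n => (A n).reverse) (fun n => (G n).reverse) where
  extendable :=
    { factor := fun {v w} hv hw => h.extendable.factor (List.reverse_infix.2 hv) hw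
      extend := fun w hw => by simpa using h.extend_left _ hw }
  extend_left w hw := by simpa using h.extendable.extend _ hw
  mem n := by simpa using h.mem n
  head n := by simpa using List.reverse_prefix.2 (h.last n)
  last n := by simpa using List.reverse_suffix.2 (h.head n)
  succ n := by rw [h.succ, spaced_reverse]
  gap n g hg := h.gap n g (List.mem_reverse.1 hg)
  short_mem n := List.mem_reverse.2 (h.short_mem n)
  long_mem n := List.mem_reverse.2 (h.long_mem n)
  lt := h.lt

theorem spaced_mem_of_isInfix (h : IsTwoGap L e f A G) {n : ℕ} {s t : List ℕ} (hs : s <:+: t)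
    (ht : spaced (A n) t ∈ L) : spaced (A n) s ∈ L :=
  h.extendable.factor (isInfix_spaced (A n) hs) ht

theorem spaced_gaps_mem (h : IsTwoGap L e f A G) (n : ℕ) : spaced (A n) (G n) ∈ L :=
  h.succ n ▸ h.mem (n + 1)

theorem spaced_singleton_mem (h : IsTwoGap L e f A G) (n : ℕ) {g : ℕ} (hg : g = e ∨ g = f) :
    spaced (A n) [g] ∈ L := by
  refine h.spaced_mem_of_isInfix ?_ (h.spaced_gaps_mem n)
  rw [List.singleton_infix_iff]
  rcases hg with rfl | rfl
  exacts [h.short_mem n, h.long_mem n]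

theorem spaced_gaps_cons_gaps_mem (h : IsTwoGap L e f A G) (n : ℕ) {g : ℕ}
    (hg : g = e ∨ g = f) : spaced (A n) (G n ++ g :: G n) ∈ L := by
  have := h.spaced_singleton_mem (n + 1) hg
  rw [h.succ] at this
  simpa [spaced_append, spaced] using this

theorem suffix_add (h : IsTwoGap L e f A G) (n k : ℕ) : A n <:+ A (n + k) := by
  induction k with
  | zero => exact List.suffix_rfl
  | succ k ih => exact ih.trans (by rw [← add_assoc, h.succ]; exact suffix_spaced _ _)

theorem lt_length (h : IsTwoGap L e f A G) (n : ℕ) : n < (A n).length := by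
  induction n with
  | zero =>
    exact (h.head 0).length_le
  | succ n ih =>
    obtain ⟨g, t, hG⟩ := List.exists_cons_of_ne_nil (List.ne_nil_of_mem (h.short_mem n))
    have := (prefix_spaced (A n) t).length_le
    rw [h.succ, hG, spaced, List.length_append, List.length_append]
    omega

theorem rightSpecial (h : IsTwoGap L e f A G) (n : ℕ) :
    RightSpecial L (A n ++ List.replicate e true) :=
  h.extendable.rightSpecial_spaced (t := []) (h.head n) h.lt
    (h.spaced_singleton_mem n (Or.inl rfl)) (h.spaced_singleton_mem n (Or.inr rfl))

theorem ncard_add_sub_le (h : IsTwoGap L e f A G) {a b : ℕ} (hab : a ≤ b) :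
    (wordsOf L a).ncard + (b - a) ≤ (wordsOf L b).ncard := by
  rw [← one_mul (b - a)]
  refine add_mul_sub_le_of_step (p := fun l => (wordsOf L l).ncard) hab fun l _ _ => ?_
  exact h.extendable.ncard_add_one_le (h.rightSpecial l)
    (by have := h.lt_length l; simp; omega)

theorem infix_of_branching (h : IsTwoGap L e f A G) (n : ℕ) (b : Bool) :
    (A n ++ List.replicate e true) ++ [b] <:+: A (n + 1) := by
  have key : ∀ g ∈ G n, e ≤ g → (A n ++ List.replicate e true) ++ [decide (e < g)] <:+:
      A (n + 1) := by
    intro g hg heg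
    have h1 : spaced (A n) [g] <:+: spaced (A n) (G n) :=
      isInfix_spaced _ ((List.singleton_infix_iff _ _).2 hg)
    rw [h.succ]
    refine List.IsInfix.trans ?_ h1
    have h2 := (List.prefix_append_right_inj (A n)).2 (prefix_replicate_append (h.head n) heg)
    simpa [spaced] using h2.isInfix
  cases b with
  | false => simpa using key e (h.short_mem n) le_rfl
  | true => simpa [h.lt] using key f (h.long_mem n) h.lt.le

theorem spaced_pair_mem (h : IsTwoGap L e f A G) (n : ℕ) {α β : ℕ}
    (hαβ : α = e ∧ β = f ∨ α = f ∧ β = e) : spaced (A n) [β, α] ∈ L := by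
  have hgap : ∀ g ∈ G n, g = α ∨ g = β := fun g hg => by
    have := h.gap n g hg
    omega
  have hmem : β ∈ G n := by
    rcases hαβ with ⟨-, rfl⟩ | ⟨-, rfl⟩
    exacts [h.long_mem n, h.short_mem n]
  obtain ⟨t, b, ht⟩ := exists_eq_append_cons_replicate hgap hmem
  refine h.spaced_mem_of_isInfix ⟨t, List.replicate b α ++ G n, ?_⟩
    (h.spaced_gaps_cons_gaps_mem n (show α = e ∨ α = f by omega))
  have h1 : List.replicate b α ++ α :: G n = α :: (List.replicate b α ++ G n) := by
    rw [← List.cons_append, ← List.replicate_succ, List.replicate_succ', List.append_assoc]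
    rfl
  nth_rw 2 [ht]
  simp [h1]

/-- If both `e e` and `f f` occur as successive gaps, then there are two right special words in
a whole range of lengths. -/
theorem ncard_add_two_mul_le (h : IsTwoGap L e f A G) {n : ℕ}
    (he : spaced (A n) [e, e] ∈ L) (hf : spaced (A n) [f, f] ∈ L) :
    (wordsOf L ((A n).length + 2 * e + 1)).ncard + 2 * (A n).length ≤
      (wordsOf L (2 * (A n).length + 2 * e + 1)).ncard := by
  have h1 := h.extendable.rightSpecial_spaced (t := [e]) (h.head n) h.lt he
    (h.spaced_pair_mem n (Or.inr ⟨rfl, rfl⟩))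
  have h2 := h.extendable.rightSpecial_spaced (t := [f]) (h.head n) h.lt
    (h.spaced_pair_mem n (Or.inl ⟨rfl, rfl⟩)) hf
  have hz : ∀ g, e ≤ g → decide (e < g) :: (List.replicate e true ++
      (A n ++ List.replicate e true)) <:+ spaced (A n) [g] ++ List.replicate e true := by
    intro g hg
    obtain ⟨B, hB⟩ := suffix_append_replicate (h.last n) hg
    refine ⟨B, ?_⟩
    rw [spaced, ← List.append_assoc (A n), ← hB]
    simp [spaced]
  have hlt := h.lt
  have := add_mul_sub_le_of_step (p := fun l => (wordsOf L l).ncard) (k := 2)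
    (a := (A n).length + 2 * e + 1) (b := 2 * (A n).length + 2 * e + 1) (by omega)
    (fun l hl hl' => h.extendable.ncard_add_two_le h1 h2 (hz e le_rfl) (hz f hlt.le)
      (by simp [hlt]) (by simp; omega) (by simp [spaced]; omega) (by simp [spaced]; omega))
  have h3 : 2 * (A n).length + 2 * e + 1 - ((A n).length + 2 * e + 1) = (A n).length := by omega
  rwa [h3] at this

theorem exists_large_complexity_of_gaps_eq (h : IsTwoGap L e f A G) {n α β a b : ℕ}
    {s t : List ℕ} (hαβ : α = e ∧ β = f ∨ α = f ∧ β = e) (hn : f ≤ n)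
    (hs : G (n + 1) = List.replicate a α ++ β :: s)
    (ht : G (n + 1) = t ++ β :: List.replicate b α) (hb : 1 ≤ b) (hab : b ≤ a) :
    ∃ q, n ≤ q ∧ 3 * q + n ≤ 2 * (wordsOf L q).ncard + (10 * f + 10) := by
  have hlt := h.lt
  have hα : α = e ∨ α = f := by omega
  have hβ : β = e ∨ β = f := by omega
  have hmin : min α β = e := by omega
  have hmax : max α β = f := by omega
  have hlen := h.lt_length (n + 1)
  have h1 := h.spaced_gaps_cons_gaps_mem (n + 1) hα
  have h2 := h.spaced_gaps_cons_gaps_mem (n + 1) hβ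
  rw [congrArg₂ (fun x y => x ++ α :: y) ht hs] at h1
  rw [congrArg₂ (fun x y => x ++ β :: y) ht hs] at h2
  have hrun : spaced (A (n + 1)) (List.replicate (a + 1 + b) α ++ [β]) ∈ L := by
    refine h.spaced_mem_of_isInfix ⟨t ++ [β], s, ?_⟩ h1
    rw [add_comm (a + 1), List.replicate_add, List.replicate_succ]
    simp
  have haa : spaced (A (n + 1)) [α, α] ∈ L := by
    refine h.spaced_mem_of_isInfix ⟨List.replicate (a + b - 1) α, [β], ?_⟩ hrun
    rw [show a + 1 + b = a + b - 1 + 2 by omega, List.replicate_add]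
    simp [List.replicate_succ]
  have haba : spaced (A (n + 1)) [α, β, α] ∈ L := by
    obtain ⟨a, rfl⟩ := Nat.exists_eq_add_of_le' (hb.trans hab)
    obtain ⟨b, rfl⟩ := Nat.exists_eq_add_of_le' hb
    refine h.spaced_mem_of_isInfix
      ⟨t ++ β :: List.replicate b α, List.replicate a α ++ β :: s, ?_⟩ h2
    rw [List.replicate_succ' (n := b), List.replicate_succ (n := a)]
    simp
  obtain ⟨q, hq, hq'⟩ := exists_large_complexity_of_isolated h.extendable (h.head (n + 1))
    (h.last (n + 1)) (by omega) hb (by omega) (by omega) haa haba hrun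
    (fun k => ⟨A (n + 1 + 1 + k) ++ List.replicate e true,
      by have := h.lt_length (n + 1 + 1 + k); simp; omega, h.rightSpecial _, by
        have h3 := (suffix_spaced_append (A (n + 1)) t (β :: List.replicate b α))
        rw [← ht, ← h.succ] at h3
        obtain ⟨B, hB⟩ := h3.trans (h.suffix_add (n + 1 + 1) k)
        exact ⟨B, by rw [← hB, hmin, List.append_assoc]⟩⟩)
    (h.infix_of_branching n false) (h.infix_of_branching n true)
  have hlen' := h.lt_length n
  rw [hmax, List.length_append] at hq'
  exact ⟨q, by omega, by omega⟩

theorem exists_large_complexity_of_notMem (h : IsTwoGap L e f A G) {n α β : ℕ}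
    (hαβ : α = e ∧ β = f ∨ α = f ∧ β = e) (hn : f ≤ n)
    (hββ : spaced (A (n + 1)) [β, β] ∉ L) :
    ∃ q, n ≤ q ∧ 3 * q + n ≤ 2 * (wordsOf L q).ncard + (10 * f + 10) := by
  have hlt := h.lt
  have hβ : β = e ∨ β = f := by omega
  have hgap : ∀ g ∈ G (n + 1), g = α ∨ g = β := fun g hg => by
    have := h.gap (n + 1) g hg
    omega
  have hmem : β ∈ G (n + 1) := by
    rcases hβ with rfl | rfl
    exacts [h.short_mem _, h.long_mem _]
  obtain ⟨a, s, hs⟩ := exists_eq_replicate_append_cons hgap hmem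
  obtain ⟨t, b, ht⟩ := exists_eq_append_cons_replicate hgap hmem
  have h2 := h.spaced_gaps_cons_gaps_mem (n + 1) hβ
  have ha : 1 ≤ a := by
    rw [Nat.one_le_iff_ne_zero]
    rintro rfl
    refine hββ (h.spaced_mem_of_isInfix ⟨G (n + 1), s, ?_⟩ h2)
    nth_rw 3 [hs]
    simp
  have hb : 1 ≤ b := by
    rw [Nat.one_le_iff_ne_zero]
    rintro rfl
    refine hββ (h.spaced_mem_of_isInfix ⟨t, G (n + 1), ?_⟩ h2)
    nth_rw 2 [ht]
    simp
  rcases le_total b a with hab | hab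
  · exact h.exists_large_complexity_of_gaps_eq hαβ hn hs ht hb hab
  · have := h.reverse.exists_large_complexity_of_gaps_eq (s := t.reverse) (t := s.reverse)
      hαβ hn (by simp [ht]) (by simp [hs]) ha hab
    simpa only [ncard_wordsOf_reverse] using this

theorem exists_large_complexity (h : IsTwoGap L e f A G) (k : ℕ) :
    ∃ q, k ≤ q ∧ 3 * q + k ≤ 2 * (wordsOf L q).ncard := by
  by_cases hc : ∃ n, k + 10 * f + 10 ≤ n ∧
      (spaced (A (n + 1)) [e, e] ∉ L ∨ spaced (A (n + 1)) [f, f] ∉ L)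
  · obtain ⟨n, hn, hc | hc⟩ := hc
    · obtain ⟨q, hq, hq'⟩ := h.exists_large_complexity_of_notMem (Or.inr ⟨rfl, rfl⟩)
        (by omega) hc
      exact ⟨q, by omega, by omega⟩
    · obtain ⟨q, hq, hq'⟩ := h.exists_large_complexity_of_notMem (Or.inl ⟨rfl, rfl⟩)
        (by omega) hc
      exact ⟨q, by omega, by omega⟩
  · push Not at hc
    have key : ∀ n, k + 10 * f + 10 ≤ n → (wordsOf L ((A (n + 1)).length + 2 * e + 1)).ncard +
        2 * (A (n + 1)).length ≤ (wordsOf L (2 * (A (n + 1)).length + 2 * e + 1)).ncard :=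
      fun n hn => h.ncard_add_two_mul_le (hc n hn).1 (hc n hn).2
    have h1 := key _ le_rfl
    have h2 := h.ncard_add_sub_le
      (Nat.zero_le ((A (k + 10 * f + 10 + 1)).length + 2 * e + 1))
    have h3 := h.lt_length (k + 10 * f + 10 + 1)
    set x := (A (k + 10 * f + 10 + 1)).length
    have h4 := key (2 * x) (by omega)
    have h5 := h.lt_length (2 * x + 1)
    have hlt := h.lt
    set y := (A (2 * x + 1)).length
    have h6 := h.ncard_add_sub_le (show 2 * x + 2 * e + 1 ≤ y + 2 * e + 1 by omega)
    exact ⟨2 * y + 2 * e + 1, by omega, by omega⟩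

end IsTwoGap

theorem exists_eq_append_replicate {w : List Bool} (hw : [false] <+: w) :
    ∃ A e, w = A ++ List.replicate e true ∧ [false] <+: A ∧ [false] <:+ A := by
  induction w using List.reverseRecOn with
  | nil => simp at hw
  | append_singleton w b ih =>
    cases b with
    | false => exact ⟨w ++ [false], 0, by simp, hw, List.suffix_append _ _⟩
    | true =>
      have hw' : [false] <+: w := by
        cases w with
        | nil => simp at hw
        | cons c w => simpa using hw
      obtain ⟨A, e, rfl, h0, h1⟩ := ih hw'
      exact ⟨A, e + 1, by rw [List.replicate_succ', List.append_assoc], h0, h1⟩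

theorem flatten_map_append_replicate (A : List Bool) (e : ℕ) (s : ℕ → ℕ) (m : ℕ) :
    ((List.range m).map
      fun i => A ++ List.replicate e true ++ List.replicate (s i) true).flatten ++ A =
      spaced A ((List.range m).map fun i => e + s i) := by
  induction m with
  | zero => simp [spaced]
  | succ m ih =>
    rw [List.range_succ, List.map_append, List.map_append, List.flatten_append, List.map_singleton,
      List.map_singleton, spaced_append, ← ih]
    simp [spaced]

section Bseq

variable (r : ℕ → ℕ) (s : ℕ → ℕ → ℕ)

theorem Bseq_succ {n : ℕ} (hn : 1 ≤ n) : Bseq r s (n + 1) = ((List.range (r n + 1)).map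
    fun i => Bseq r s n ++ List.replicate (s n i) true).flatten := by
  obtain ⟨n, rfl⟩ := Nat.exists_eq_add_of_le' hn
  rw [Bseq]

theorem head_Bseq (n : ℕ) : [false] <+: Bseq r s n := by
  induction n with
  | zero => exact List.prefix_rfl
  | succ n ih =>
    rcases n.eq_zero_or_pos with rfl | hn
    · exact List.prefix_rfl
    · rw [Bseq_succ r s hn, List.range_succ_eq_map]
      refine ih.trans ?_
      simp

variable {r}

theorem exists_Bseq_succ_eq (hr : ∀ n, 1 ≤ r n) {n : ℕ} (hn : 1 ≤ n) :
    ∃ b u c v w, Bseq r s (n + 1) = Bseq r s n ++ b :: u ∧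
      Bseq r s (n + 1) = v ++ c :: (Bseq r s n ++ w) := by
  obtain ⟨x, hx⟩ := head_Bseq r s n
  obtain ⟨k, hk⟩ := Nat.exists_eq_add_of_le' (hr n)
  have hne : Bseq r s n ≠ [] := by rw [← hx]; simp
  have h1 : ∃ y, y ≠ [] ∧ Bseq r s (n + 1) = Bseq r s n ++ y := by
    rw [Bseq_succ r s hn, hk, List.range_succ_eq_map, List.range_succ_eq_map]
    refine ⟨_, ?_, by rw [List.map_cons, List.flatten_cons, List.append_assoc]⟩
    simp [hne]
  have h2 : ∃ y z, y ≠ [] ∧ Bseq r s (n + 1) = y ++ (Bseq r s n ++ z) := by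
    rw [Bseq_succ r s hn, hk, List.range_succ, List.map_append, List.flatten_append]
    refine ⟨_, List.replicate (s n (k + 1)) true, ?_, by rw [List.map_singleton]; simp; rfl⟩
    rw [List.range_succ]
    simp [hne]
  obtain ⟨y, hy, h1⟩ := h1
  obtain ⟨y', z, hy', h2⟩ := h2
  obtain ⟨b, u, rfl⟩ := List.exists_cons_of_ne_nil hy
  refine ⟨b, u, y'.getLast hy', y'.dropLast, z, h1, ?_⟩
  rw [h2]
  conv_lhs => rw [← List.dropLast_append_getLast hy']
  simp

theorem exists_infix_Bseq_of_inLang {w : List Bool} (hw : InLang r s w) :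
    ∃ n, 1 ≤ n ∧ w <:+: Bseq r s n := by
  obtain ⟨n, hn⟩ := hw
  rcases n.eq_zero_or_pos with rfl | hn'
  exacts [⟨1, le_rfl, hn⟩, ⟨n, hn', hn⟩]

theorem isExtendable_inLang (hr : ∀ n, 1 ≤ r n) : IsExtendable {w | InLang r s w} where
  factor := fun {v w} hv ⟨n, hn⟩ => ⟨n, hv.trans hn⟩
  extend := fun w hw => by
    obtain ⟨n, hn, p, q, hpq⟩ := exists_infix_Bseq_of_inLang s hw
    obtain ⟨b, u, -, -, -, hu, -⟩ := exists_Bseq_succ_eq s hr hn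
    cases q with
    | nil => exact ⟨b, n + 1, p, u, by rw [hu, ← hpq]; simp⟩
    | cons c q => exact ⟨c, n, p, q, by rw [← hpq]; simp⟩

theorem exists_cons_inLang (hr : ∀ n, 1 ≤ r n) {w : List Bool} (hw : InLang r s w) :
    ∃ b, InLang r s (b :: w) := by
  obtain ⟨n, hn, p, q, hpq⟩ := exists_infix_Bseq_of_inLang s hw
  obtain ⟨-, -, c, v, x, -, hu⟩ := exists_Bseq_succ_eq s hr hn
  rcases List.eq_nil_or_concat p with rfl | ⟨p, b, rfl⟩
  · exact ⟨c, n + 1, v, q ++ x, by rw [hu, ← hpq]; simp⟩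
  · exact ⟨b, n, p, q, by rw [← hpq]; simp⟩

theorem exists_isTwoGap (hr : ∀ n, 1 ≤ r n) {d : ℕ} (hd : 1 ≤ d) {N : ℕ} (hN : 1 ≤ N)
    (hyp : ∀ n, N ≤ n →
      (∀ i, i < r n → s n i = 0 ∨ s n i = d) ∧
      s n (r n) = 0 ∧
      (∃ i, i < r n ∧ s n i = 0) ∧ (∃ i, i < r n ∧ s n i = d)) :
    ∃ e A G, IsTwoGap {w | InLang r s w} e (e + d) A G := by
  obtain ⟨A₀, e, h₀, h0, h1⟩ := exists_eq_append_replicate (head_Bseq r s N)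
  let G : ℕ → List ℕ := fun k => (List.range (r (N + k))).map fun i => e + s (N + k) i
  let A : ℕ → List Bool := fun k => k.rec A₀ fun n c => spaced c (G n)
  have hA : ∀ k, A (k + 1) = spaced (A k) (G k) := fun _ => rfl
  have hB : ∀ k, Bseq r s (N + k) = A k ++ List.replicate e true := by
    intro k
    induction k with
    | zero => exact h₀
    | succ k ih =>
      have hk := (hyp (N + k) (by omega)).2.1
      rw [← add_assoc, Bseq_succ r s (by omega), hA, ih, List.range_succ, List.map_append,
        List.flatten_append, ← flatten_map_append_replicate]
      simp [hk]
  refine ⟨e, A, G, isExtendable_inLang s hr, fun w hw => exists_cons_inLang s hr hw,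
    fun k => ⟨N + k, by rw [hB]; exact (List.prefix_append _ _).isInfix⟩, fun k => ?_,
    fun k => ?_, hA, fun k g hg => ?_, fun k => ?_, fun k => ?_, by omega⟩
  · induction k with
    | zero => exact h0
    | succ k ih => exact ih.trans (prefix_spaced _ _)
  · induction k with
    | zero => exact h1
    | succ k ih => exact ih.trans (suffix_spaced _ _)
  · obtain ⟨i, hi, rfl⟩ := List.mem_map.1 hg
    rcases (hyp (N + k) (by omega)).1 i (List.mem_range.1 hi) with h | h <;> simp [h]
  · obtain ⟨i, hi, h⟩ := (hyp (N + k) (by omega)).2.2.1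
    exact List.mem_map.2 ⟨i, List.mem_range.2 hi, by simp [h]⟩
  · obtain ⟨i, hi, h⟩ := (hyp (N + k) (by omega)).2.2.2
    exact List.mem_map.2 ⟨i, List.mem_range.2 hi, by simp [h]⟩

end Bseq

/-- If for all `n ≥ N` the spacers satisfy `s_{n,i} ∈ {0,d}` (`0 ≤ i < r_n`),
`s_{n,r_n} = 0`, and both values occur (with `d ≥ 1`), then
`limsup (p(q) - 1.5 q) = ∞`. -/
theorem stmt12 (r : ℕ → ℕ) (s : ℕ → ℕ → ℕ) (hr : ∀ n, 1 ≤ r n)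
    (d : ℕ) (hd : 1 ≤ d) (N : ℕ) (hN : 1 ≤ N)
    (hyp : ∀ n, N ≤ n →
      (∀ i, i < r n → s n i = 0 ∨ s n i = d) ∧
      s n (r n) = 0 ∧
      (∃ i, i < r n ∧ s n i = 0) ∧ (∃ i, i < r n ∧ s n i = d)) :
    ∀ C : ℝ, ∃ᶠ q : ℕ in atTop,
      C < (complexity r s q : ℝ) - (3 / 2 : ℝ) * q := by
  intro C
  obtain ⟨e, A, G, h⟩ := exists_isTwoGap s hr hd hN hyp
  obtain ⟨K, hK⟩ := exists_nat_gt (2 * C)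
  rw [Filter.frequently_atTop]
  intro a
  obtain ⟨q, hq, hq'⟩ := h.exists_large_complexity (a + K)
  refine ⟨q, by omega, ?_⟩
  change 3 * q + (a + K) ≤ 2 * complexity r s q at hq'
  have h1 : 3 * (q : ℝ) + (a + K) ≤ 2 * complexity r s q := by exact_mod_cast hq'
  have h2 : (0 : ℝ) ≤ a := Nat.cast_nonneg a
  linarith
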